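/- arXiv:1407.8359 — 3 statements merged into one kernel-verified Lean document; each statement's English description precedes it below -/
import Mathlib

section
/- For Lebesgue-almost every tuple of nine complex matrices (H̄_{j,i})_{j,i ∈ {1,2,3}} with H̄_{j,i} ∈ ℂ^{3×2}, the following holds. Let T = 5 and let H_{j,i} ∈ ℝ^{30×20} be the real block matrix whose (q,r)-th 10×10 block is C_T(H̄_{j,i}(q,r)) for q ∈ {1,2,3}, r ∈ {1,2}. Then there exist matrices V_1, V_2, V_3 ∈ ℝ^{20×12} and W_1, W_2, W_3 ∈ ℝ^{12×30} such that W_j·H_{j,i}·V_i = 0 for all i ≠ j and W_j·H_{j,j}·V_j is invertible for every j ∈ {1,2,3}. -/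
open Matrix MeasureTheory

/-- The ACS extension of a complex number `h` with `T` symbol extensions in time:
`C_T(h) = I_T ⊗ [[Re h, −Im h], [Im h, Re h]] ∈ ℝ^{2T×2T}`. -/
noncomputable def Cmat (T : ℕ) (h : ℂ) : Matrix (Fin (2 * T)) (Fin (2 * T)) ℝ :=
  Matrix.of fun i j =>
    if (i : ℕ) / 2 = (j : ℕ) / 2 then
      !![h.re, -h.im; h.im, h.re] ⟨(i : ℕ) % 2, Nat.mod_lt _ (by norm_num)⟩
        ⟨(j : ℕ) % 2, Nat.mod_lt _ (by norm_num)⟩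
    else 0

/-- Assemble an `R×C` block matrix with `m×n` blocks into a full `(R*m)×(C*n)` matrix. -/
noncomputable def blk {α : Type*} {R C m n : ℕ}
    (f : Fin R → Fin C → Matrix (Fin m) (Fin n) α) :
    Matrix (Fin (R * m)) (Fin (C * n)) α :=
  Matrix.of fun i j =>
    f ⟨(i : ℕ) / m, Nat.div_lt_of_lt_mul (Nat.mul_comm R m ▸ i.2)⟩
      ⟨(j : ℕ) / n, Nat.div_lt_of_lt_mul (Nat.mul_comm C n ▸ j.2)⟩
      ⟨(i : ℕ) % m, Nat.mod_lt _ (by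
        rcases Nat.eq_zero_or_pos m with hm | hm
        · subst hm; exact absurd i.2 (by omega)
        · exact hm)⟩
      ⟨(j : ℕ) % n, Nat.mod_lt _ (by
        rcases Nat.eq_zero_or_pos n with hn | hn
        · subst hn; exact absurd j.2 (by omega)
        · exact hn)⟩

/-- The extended real channel from transmitter `i` to receiver `j` in the (2,3) case:
the 30×20 real block matrix whose `(q,r)`-th 10×10 block is `C_5(H̄_{j,i}(q,r))`. -/
noncomputable def Hext (H : Fin 3 → Fin 3 → Fin 3 → Fin 2 → ℂ) (j i : Fin 3) :
    Matrix (Fin 30) (Fin 20) ℝ :=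
  blk (R := 3) (C := 2) (m := 10) (n := 10) fun q r => Cmat 5 (H j i q r)

open scoped ContDiff

/-- A real-analytic function on a finite-dimensional space which is not identically zero is
nonzero almost everywhere. -/
theorem ContDiff.ae_ne_zero {E : Type*} [NormedAddCommGroup E] [NormedSpace ℝ E]
    [FiniteDimensional ℝ E] [MeasurableSpace E] [BorelSpace E] (μ : Measure E)
    [μ.IsAddHaarMeasure] {f : E → ℝ} (hf : ContDiff ℝ ω f) {x₀ : E} (hx₀ : f x₀ ≠ 0) :
    ∀ᵐ x ∂μ, f x ≠ 0 := by
  have hline : ∀ x : E, ∀ᵐ t : ℝ, f (x₀ + t • x) ≠ 0 := fun x => by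
    have hfx : ContDiff ℝ ω fun t : ℝ => f (x₀ + t • x) := by fun_prop
    have hmem := hfx.analyticOnNhd.preimage_zero_mem_codiscrete (x := 0) (by simpa using hx₀)
    have hle := ae_restrict_le_codiscreteWithin (μ := (volume : Measure ℝ)) MeasurableSet.univ hmem
    rwa [Measure.restrict_univ] at hle
  have hmeas : MeasurableSet {p : E × ℝ | f (x₀ + p.2 • p.1) ≠ 0} := by
    have hcont := hf.continuous
    exact (isOpen_ne_fun (by fun_prop) continuous_const).measurableSet
  have hswap : ∀ᵐ t : ℝ, ∀ᵐ x ∂μ, f (x₀ + t • x) ≠ 0 :=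
    (Measure.ae_ae_comm hmeas).1 (.of_forall hline)
  obtain ⟨t, ht, ht₀⟩ :=
    (hswap.and (compl_mem_ae_iff.2 (measure_singleton (0 : ℝ)))).exists
  have ht₀ : t ≠ 0 := ht₀
  rw [ae_iff] at ht ⊢
  have hpre : {x | ¬ f (x₀ + t • x) ≠ 0} =
      (t • ·) ⁻¹' ((x₀ + ·) ⁻¹' {x | ¬ f x ≠ 0}) := rfl
  rw [hpre, Measure.addHaar_preimage_smul μ ht₀, measure_preimage_add] at ht
  refine (mul_eq_zero.1 ht).resolve_left ?_
  simp [ht₀]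

/-- Real coordinates of a `k`-antenna complex signal over five channel uses. -/
def signalIndex (k : ℕ) : Fin k × Fin 5 × Fin 2 ≃ Fin (k * 10) :=
  ((Equiv.refl _).prodCongr finProdFinEquiv).trans finProdFinEquiv

theorem signalIndex_val (k : ℕ) (q : Fin k) (t : Fin 5) (a : Fin 2) :
    (signalIndex k (q, t, a) : ℕ) = a + 2 * t + 10 * q := by
  simp [signalIndex, finProdFinEquiv]

/-- Identification of `k`-antenna complex signals over five channel uses with real vectors. -/
noncomputable def realify (k : ℕ) : (Fin k → Fin 5 → ℂ) ≃ₗ[ℝ] (Fin (k * 10) → ℝ) where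
  toFun x n :=
    let p := (signalIndex k).symm n
    ![(x p.1 p.2.1).re, (x p.1 p.2.1).im] p.2.2
  invFun v q t := ⟨v (signalIndex k (q, t, 0)), v (signalIndex k (q, t, 1))⟩
  map_add' x y := by
    funext n
    obtain ⟨⟨q, t, a⟩, rfl⟩ := (signalIndex k).surjective n
    fin_cases a <;> simp
  map_smul' c x := by
    funext n
    obtain ⟨⟨q, t, a⟩, rfl⟩ := (signalIndex k).surjective n
    fin_cases a <;> simp
  left_inv x := by
    funext q t
    simp
  right_inv v := by
    funext n
    obtain ⟨⟨q, t, a⟩, rfl⟩ := (signalIndex k).surjective n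
    fin_cases a <;> simp

theorem realify_apply (k : ℕ) (x : Fin k → Fin 5 → ℂ) (q : Fin k) (t : Fin 5) (a : Fin 2) :
    realify k x (signalIndex k (q, t, a)) = ![(x q t).re, (x q t).im] a := by
  simp [realify]

/-- The action of a constant channel matrix on signals over five channel uses. -/
noncomputable def channelMap (A : Fin 3 → Fin 2 → ℂ) :
    (Fin 2 → Fin 5 → ℂ) →ₗ[ℝ] (Fin 3 → Fin 5 → ℂ) where
  toFun x q t := ∑ r, A q r * x r t
  map_add' x y := by
    funext q t
    simp [mul_add, Finset.sum_add_distrib]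
  map_smul' c x := by
    funext q t
    simp
    ring

theorem Hext_signalIndex (H : Fin 3 → Fin 3 → Fin 3 → Fin 2 → ℂ) (j i : Fin 3)
    (q : Fin 3) (t : Fin 5) (a : Fin 2) (r : Fin 2) (s : Fin 5) (b : Fin 2) :
    Hext H j i (signalIndex 3 (q, t, a)) (signalIndex 2 (r, s, b)) =
      if t = s then !![(H j i q r).re, -(H j i q r).im; (H j i q r).im, (H j i q r).re] a b
      else 0 := by
  have hq : ((a : ℕ) + 2 * t + 10 * q) / 10 = q := by omega
  have ht : ((a : ℕ) + 2 * t + 10 * q) % 10 / 2 = t := by omega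
  have ha : ((a : ℕ) + 2 * t + 10 * q) % 10 % 2 = a := by omega
  have hr : ((b : ℕ) + 2 * s + 10 * r) / 10 = r := by omega
  have hs : ((b : ℕ) + 2 * s + 10 * r) % 10 / 2 = s := by omega
  have hb : ((b : ℕ) + 2 * s + 10 * r) % 10 % 2 = b := by omega
  simp only [Hext, blk, Cmat, Matrix.of_apply, signalIndex_val, hq, ht, ha, hr, hs, hb,
    Fin.val_inj, Fin.eta]

theorem Hext_mulVec_realify (H : Fin 3 → Fin 3 → Fin 3 → Fin 2 → ℂ) (j i : Fin 3)
    (x : Fin 2 → Fin 5 → ℂ) :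
    Hext H j i *ᵥ realify 2 x = realify 3 (channelMap (H j i) x) := by
  funext n
  obtain ⟨⟨q, t, a⟩, rfl⟩ := (signalIndex 3).surjective n
  rw [realify_apply, Matrix.mulVec, dotProduct]
  erw [← (signalIndex 2).sum_comp]
  simp only [Hext_signalIndex, realify_apply, Fintype.sum_prod_type, ite_mul, zero_mul,
    Fin.sum_univ_two, channelMap, LinearMap.coe_mk, AddHom.coe_mk, Finset.sum_add_distrib,
    Finset.sum_ite_eq, Finset.mem_univ, if_true]
  fin_cases a <;> simp <;> ring

theorem Hext_eq_toMatrix' (H : Fin 3 → Fin 3 → Fin 3 → Fin 2 → ℂ) (j i : Fin 3) :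
    Hext H j i = LinearMap.toMatrix'
      ((realify 3).toLinearMap ∘ₗ channelMap (H j i) ∘ₗ (realify 2).symm.toLinearMap) := by
  rw [← LinearMap.toMatrix'_toLin' (Hext H j i)]
  congr 1
  refine LinearMap.ext fun v => ?_
  obtain ⟨x, rfl⟩ := (realify 2).surjective v
  simpa using Hext_mulVec_realify H j i x

/-- The signed maximal minors of the `3 × 4` matrix `[A B]`. -/
noncomputable def alignMinor (A B : Fin 3 → Fin 2 → ℂ) (n : Fin 4) : ℂ :=
  (-1) ^ (n : ℕ) *
    (Matrix.of fun q k => (![A q 0, A q 1, B q 0, B q 1] : Fin 4 → ℂ) (n.succAbove k)).det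

/-- The direction at the first transmitter which aligns with `alignRight` at the receiver. -/
noncomputable def alignLeft (A B : Fin 3 → Fin 2 → ℂ) : Fin 2 → ℂ :=
  ![alignMinor A B 0, alignMinor A B 1]

/-- The direction at the second transmitter which aligns with `alignLeft` at the receiver. -/
noncomputable def alignRight (A B : Fin 3 → Fin 2 → ℂ) : Fin 2 → ℂ :=
  ![alignMinor A B 2, alignMinor A B 3]

theorem align_sum_eq_zero (A B : Fin 3 → Fin 2 → ℂ) (q : Fin 3) :
    ∑ r, A q r * alignLeft A B r + ∑ r, B q r * alignRight A B r = 0 := by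
  fin_cases q <;>
  · simp [alignLeft, alignRight, alignMinor, Matrix.det_fin_three, Fin.sum_univ_two,
      Fin.succAbove, Fin.lt_def]
    ring

/-- Send a scalar signal over five channel uses along a fixed beam direction. -/
noncomputable def beam (a : Fin 2 → ℂ) : (Fin 5 → ℂ) →ₗ[ℝ] (Fin 2 → Fin 5 → ℂ) where
  toFun u r t := a r * u t
  map_add' u v := by
    funext r t
    simp [mul_add]
  map_smul' c u := by
    funext r t
    simp
    ring

/-- Real-linear embeddings of `ℂ³` into `ℂ⁵`: the image of the `j`-th one consists of the vectors
`v` with `v (j + 1) = conj (v 3)` and `v (j + 2) = conj (v 4)`, with `j + 1`, `j + 2` modulo 3. -/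
noncomputable def chainCode (j : Fin 3) : (Fin 3 → ℂ) →ₗ[ℝ] (Fin 5 → ℂ) where
  toFun z :=
    let c : Fin 3 → ℂ := ![z 0, star (z 1), star (z 2)]
    ![c (0 - j), c (1 - j), c (2 - j), z 1, z 2]
  map_add' z w := by
    funext t
    fin_cases j <;> fin_cases t <;> simp
  map_smul' r z := by
    funext t
    fin_cases j <;> fin_cases t <;> simp

/-- The precoder of transmitter `i`, which takes part in the alignment chains of both other
receivers. -/
noncomputable def precoder (H : Fin 3 → Fin 3 → Fin 3 → Fin 2 → ℂ) (i : Fin 3) :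
    ((Fin 3 → ℂ) × (Fin 3 → ℂ)) →ₗ[ℝ] (Fin 2 → Fin 5 → ℂ) :=
  (beam (alignLeft (H (i + 2) i) (H (i + 2) (i + 1))) ∘ₗ chainCode (i + 2)).coprod
    (beam (alignRight (H (i + 1) (i + 2)) (H (i + 1) i)) ∘ₗ chainCode (i + 1))

/-- The joint map from the desired signal and the interference to the signal at receiver `j`,
in which the aligned part of the interference is counted once. -/
noncomputable def receiverMap (H : Fin 3 → Fin 3 → Fin 3 → Fin 2 → ℂ) (j : Fin 3) :
    (((Fin 3 → ℂ) × (Fin 3 → ℂ)) × ((Fin 3 → ℂ) × (Fin 3 → ℂ)) × (Fin 3 → ℂ)) →ₗ[ℝ]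
      (Fin 3 → Fin 5 → ℂ) :=
  (channelMap (H j j) ∘ₗ precoder H j).coprod
    ((channelMap (H j (j + 1)) ∘ₗ precoder H (j + 1)).coprod
      (channelMap (H j (j + 2)) ∘ₗ precoder H (j + 2) ∘ₗ LinearMap.inl ℝ _ _))

theorem channelMap_precoder_aligned (H : Fin 3 → Fin 3 → Fin 3 → Fin 2 → ℂ) (j : Fin 3)
    (z : Fin 3 → ℂ) :
    channelMap (H j (j + 2)) (precoder H (j + 2) (0, z)) =
      channelMap (H j (j + 1)) (precoder H (j + 1) (-z, 0)) := by
  have h₁ : j + 1 + 2 = j := by fin_cases j <;> rfl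
  have h₂ : j + 2 + 1 = j := by fin_cases j <;> rfl
  have h₃ : j + 2 + 2 = j + 1 := by fin_cases j <;> rfl
  have h₄ : j + 1 + 1 = j + 2 := by fin_cases j <;> rfl
  funext q t
  have hsum := align_sum_eq_zero (H j (j + 1)) (H j (j + 2)) q
  simp only [precoder, h₁, h₂, h₃, h₄, LinearMap.coprod_apply, LinearMap.comp_apply, map_zero,
    map_neg, zero_add, add_zero, channelMap, beam, LinearMap.coe_mk, AddHom.coe_mk,
    Fin.sum_univ_two, Pi.neg_apply] at hsum ⊢
  linear_combination hsum * chainCode j z t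

theorem exists_zeroForcing {H : Fin 3 → Fin 3 → Fin 3 → Fin 2 → ℂ} {j : Fin 3}
    (hinj : Function.Injective (receiverMap H j)) :
    ∃ w : (Fin 3 → Fin 5 → ℂ) →ₗ[ℝ] ((Fin 3 → ℂ) × (Fin 3 → ℂ)),
      (∀ i, i ≠ j → w ∘ₗ channelMap (H j i) ∘ₗ precoder H i = 0) ∧
        w ∘ₗ channelMap (H j j) ∘ₗ precoder H j = LinearMap.id := by
  obtain ⟨g, hg⟩ := (receiverMap H j).exists_leftInverse_of_injective (LinearMap.ker_eq_bot.2 hinj)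
  have hg : ∀ x, g (receiverMap H j x) = x := fun x => LinearMap.congr_fun hg x
  have hnext : ∀ x, (g (channelMap (H j (j + 1)) (precoder H (j + 1) x))).1 = 0 := fun x => by
    have hx := congrArg Prod.fst (hg (0, x, 0))
    simpa [receiverMap, Prod.mk_zero_zero] using hx
  have hprev : ∀ x, (g (channelMap (H j (j + 2)) (precoder H (j + 2) x))).1 = 0 := fun ⟨x, y⟩ => by
    have hx := congrArg Prod.fst (hg (0, 0, x))
    have hxy : ((x, y) : (Fin 3 → ℂ) × (Fin 3 → ℂ)) = (x, 0) + (0, y) := by simp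
    rw [hxy, map_add, map_add, map_add, channelMap_precoder_aligned, Prod.fst_add, hnext, add_zero]
    simpa [receiverMap, Prod.mk_zero_zero] using hx
  refine ⟨LinearMap.fst ℝ _ _ ∘ₗ g, fun i hij => LinearMap.ext fun x => ?_,
    LinearMap.ext fun x => ?_⟩
  · obtain rfl | rfl : i = j + 1 ∨ i = j + 2 := by
      clear * - hij
      decide +revert
    · exact hnext x
    · exact hprev x
  · have hx := congrArg Prod.fst (hg (x, 0, 0))
    simpa [receiverMap, Prod.mk_zero_zero] using hx

/-- A channel for which the desired signal and the interference are independent at all three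
receivers. -/
noncomputable def separatedChannel (j i : Fin 3) : Fin 3 → Fin 2 → ℂ :=
  if i = j then ![![1, 1], ![Complex.I, 0], ![0, Complex.I]]
  else if i = j + 1 then ![![1, 0], ![0, 1], ![0, 0]]
  else ![![0, -1], ![0, 0], ![1, 0]]

theorem alignLeft_separatedChannel (j : Fin 3) :
    alignLeft (separatedChannel j (j + 1)) (separatedChannel j (j + 2)) = ![-1, 0] := by
  fin_cases j <;>
  simp [alignLeft, alignMinor, separatedChannel, Matrix.det_fin_three, Fin.succAbove, Fin.lt_def]

theorem alignRight_separatedChannel (j : Fin 3) :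
    alignRight (separatedChannel j (j + 1)) (separatedChannel j (j + 2)) = ![0, -1] := by
  fin_cases j <;>
  · simp [alignRight, alignMinor, separatedChannel, Matrix.det_fin_three, Fin.succAbove, Fin.lt_def]
    norm_num

theorem precoder_separatedChannel (i : Fin 3) (x y : Fin 3 → ℂ) :
    precoder separatedChannel i (x, y) = ![-chainCode (i + 2) x, -chainCode (i + 1) y] := by
  have hl := alignLeft_separatedChannel (i + 2)
  have hr := alignRight_separatedChannel (i + 1)
  have h₁ : i + 2 + 1 = i := by fin_cases i <;> rfl
  have h₂ : i + 2 + 2 = i + 1 := by fin_cases i <;> rfl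
  have h₃ : i + 1 + 1 = i + 2 := by fin_cases i <;> rfl
  have h₄ : i + 1 + 2 = i := by fin_cases i <;> rfl
  rw [h₁, h₂] at hl
  rw [h₃, h₄] at hr
  funext r t
  fin_cases r <;> simp [precoder, beam, hl, hr]

/-- If `i z` and `-w` agree on the image of `chainCode j`, their last two coordinates vanish. -/
theorem eq_zero_of_I_mul_chainCode_add {j : Fin 3} {z w : Fin 3 → ℂ}
    (h : ∀ t, Complex.I * chainCode j z t + chainCode j w t = 0) :
    Complex.I * z 0 + w 0 = 0 ∧ z 1 = 0 ∧ z 2 = 0 ∧ w 1 = 0 ∧ w 2 = 0 := by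
  have hconj {a b : ℂ} (h₁ : Complex.I * a + b = 0)
      (h₂ : Complex.I * starRingEnd ℂ a + starRingEnd ℂ b = 0) : a = 0 ∧ b = 0 := by
    have h₃ : -Complex.I * a + b = 0 := by simpa using congrArg (starRingEnd ℂ) h₂
    have hb : b = 0 := by linear_combination (h₁ + h₃) / 2
    refine ⟨?_, hb⟩
    simpa [hb] using h₁
  have h₀ := h 0
  have h₁ := h 1
  have h₂ := h 2
  have h₃ := h 3
  have h₄ := h 4
  fin_cases j <;> simp [chainCode] at h₀ h₁ h₂ h₃ h₄
  · obtain ⟨hz, hw⟩ := hconj h₃ h₁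
    obtain ⟨hz', hw'⟩ := hconj h₄ h₂
    exact ⟨h₀, hz, hz', hw, hw'⟩
  · obtain ⟨hz, hw⟩ := hconj h₃ h₂
    obtain ⟨hz', hw'⟩ := hconj h₄ h₀
    exact ⟨h₁, hz, hz', hw, hw'⟩
  · obtain ⟨hz, hw⟩ := hconj h₃ h₀
    obtain ⟨hz', hw'⟩ := hconj h₄ h₁
    exact ⟨h₂, hz, hz', hw, hw'⟩

theorem eq_zero_of_chainCode_sum {j : Fin 3} {x y z : Fin 3 → ℂ}
    (hx₁ : x 1 = 0) (hx₂ : x 2 = 0) (hy₁ : y 1 = 0) (hy₂ : y 2 = 0)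
    (h : chainCode (j + 2) x + chainCode (j + 1) y + chainCode j z = 0) :
    x = 0 ∧ y = 0 ∧ z = 0 := by
  have h₀ := congrFun h 0
  have h₁ := congrFun h 1
  have h₂ := congrFun h 2
  have h₃ := congrFun h 3
  have h₄ := congrFun h 4
  fin_cases j <;> simp [chainCode, hx₁, hx₂, hy₁, hy₂] at h₀ h₁ h₂ h₃ h₄ <;>
  · simp [h₃, h₄] at h₀ h₁ h₂
    simp [funext_iff, Fin.forall_fin_succ, *]

theorem receiverMap_separatedChannel_injective (j : Fin 3) :
    Function.Injective (receiverMap separatedChannel j) := by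
  have h₁ : j + 1 + 2 = j := by fin_cases j <;> rfl
  have h₂ : j + 2 + 1 = j := by fin_cases j <;> rfl
  have h₃ : j + 2 + 2 = j + 1 := by fin_cases j <;> rfl
  have h₄ : j + 1 + 1 = j + 2 := by fin_cases j <;> rfl
  have hself : separatedChannel j j = ![![1, 1], ![Complex.I, 0], ![0, Complex.I]] := by
    simp [separatedChannel]
  have hnext : separatedChannel j (j + 1) = ![![1, 0], ![0, 1], ![0, 0]] := by
    simp [separatedChannel]
  have hprev : separatedChannel j (j + 2) = ![![0, -1], ![0, 0], ![1, 0]] := by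
    fin_cases j <;> simp [separatedChannel]
  rw [← LinearMap.ker_eq_bot, LinearMap.ker_eq_bot']
  rintro ⟨⟨s, t⟩, ⟨u, v⟩, w⟩ hker
  have heq (q : Fin 3) (n : Fin 5) := congrFun (congrFun hker q) n
  simp only [receiverMap, LinearMap.coprod_apply, LinearMap.comp_apply, LinearMap.inl_apply,
    precoder_separatedChannel, hself, hnext, hprev, h₁, h₂, h₃, h₄, channelMap, LinearMap.coe_mk,
    AddHom.coe_mk, Pi.add_apply, Pi.zero_apply, Fin.sum_univ_two, map_zero] at heq
  have heq₀ := heq 0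
  have heq₁ := heq 1
  have heq₂ := heq 2
  simp at heq₀ heq₁ heq₂
  obtain ⟨hv₀, hs₁, hs₂, hv₁, hv₂⟩ := eq_zero_of_I_mul_chainCode_add (j := j + 2) (z := s) (w := v)
    fun n => by linear_combination -heq₁ n
  obtain ⟨hw₀, ht₁, ht₂, hw₁, hw₂⟩ := eq_zero_of_I_mul_chainCode_add (j := j + 1) (z := t) (w := w)
    fun n => by linear_combination -heq₂ n
  obtain ⟨rfl, rfl, rfl⟩ := eq_zero_of_chainCode_sum (j := j) (z := u) hs₁ hs₂ ht₁ ht₂ <| by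
    funext n
    simp only [Pi.add_apply, Pi.zero_apply]
    linear_combination -heq₀ n
  have hv : v = 0 := by
    funext n
    fin_cases n <;> simp_all
  have hw : w = 0 := by
    funext n
    fin_cases n <;> simp_all
  rw [hv, hw]
  rfl

theorem contDiff_alignMinor {A B : (Fin 3 → Fin 3 → Fin 3 → Fin 2 → ℂ) → Fin 3 → Fin 2 → ℂ}
    (hA : ∀ q r, ContDiff ℝ ω fun H => A H q r) (hB : ∀ q r, ContDiff ℝ ω fun H => B H q r)
    (n : Fin 4) : ContDiff ℝ ω fun H => alignMinor (A H) (B H) n := by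
  simp only [alignMinor, Matrix.det_fin_three, Matrix.of_apply]
  have hcol (q : Fin 3) (m : Fin 4) :
      ContDiff ℝ ω fun H => (![A H q 0, A H q 1, B H q 0, B H q 1] : Fin 4 → ℂ) m := by
    fin_cases m
    · exact hA q 0
    · exact hA q 1
    · exact hB q 0
    · exact hB q 1
  fun_prop

theorem contDiff_precoder (i : Fin 3) (x : (Fin 3 → ℂ) × (Fin 3 → ℂ)) (r : Fin 2) (t : Fin 5) :
    ContDiff ℝ ω fun H => precoder H i x r t := by
  have hminor (j k l : Fin 3) (n : Fin 4) :
      ContDiff ℝ ω fun H : Fin 3 → Fin 3 → Fin 3 → Fin 2 → ℂ => alignMinor (H j k) (H j l) n :=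
    contDiff_alignMinor (by fun_prop) (by fun_prop) n
  simp only [precoder, LinearMap.coprod_apply, LinearMap.comp_apply, beam, LinearMap.coe_mk,
    AddHom.coe_mk, Pi.add_apply, alignLeft, alignRight]
  fin_cases r <;> simp <;> fun_prop

theorem contDiff_receiverMap (j : Fin 3)
    (x : ((Fin 3 → ℂ) × (Fin 3 → ℂ)) × ((Fin 3 → ℂ) × (Fin 3 → ℂ)) × (Fin 3 → ℂ)) :
    ContDiff ℝ ω fun H => receiverMap H j x := by
  have hpre := contDiff_precoder
  refine contDiff_pi.2 fun q => contDiff_pi.2 fun t => ?_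
  simp only [receiverMap, LinearMap.coprod_apply, LinearMap.comp_apply, channelMap,
    LinearMap.coe_mk, AddHom.coe_mk, Pi.add_apply]
  fun_prop

/-- A real-analytic family of linear maps between spaces of equal dimension which has one injective
member is almost everywhere injective. -/
theorem ae_injective_of_contDiff {E X Y : Type*} [NormedAddCommGroup E] [NormedSpace ℝ E]
    [FiniteDimensional ℝ E] [MeasurableSpace E] [BorelSpace E] (μ : Measure E)
    [μ.IsAddHaarMeasure] [AddCommGroup X] [Module ℝ X] [FiniteDimensional ℝ X]
    [NormedAddCommGroup Y] [NormedSpace ℝ Y] [FiniteDimensional ℝ Y]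
    (hdim : Module.finrank ℝ X = Module.finrank ℝ Y) {F : E → X →ₗ[ℝ] Y}
    (hF : ∀ x, ContDiff ℝ ω fun p => F p x) {p₀ : E} (hp₀ : Function.Injective (F p₀)) :
    ∀ᵐ p ∂μ, Function.Injective (F p) := by
  let e := LinearEquiv.ofFinrankEq Y X hdim.symm
  let b := Module.finBasis ℝ X
  have hdet (p : E) : LinearMap.det (e.toLinearMap ∘ₗ F p) ≠ 0 ↔ Function.Injective (F p) := by
    rw [ne_eq, LinearMap.det_eq_zero_iff_ker_ne_bot, not_not, LinearEquiv.ker_comp,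
      LinearMap.ker_eq_bot]
  have hcont : ContDiff ℝ ω fun p => LinearMap.det (e.toLinearMap ∘ₗ F p) := by
    simp only [← LinearMap.det_toMatrix b, Matrix.det_apply]
    refine ContDiff.sum fun σ _ => ContDiff.const_smul _ (contDiff_prod fun i _ => ?_)
    rw [show (fun p => LinearMap.toMatrix b b (e.toLinearMap ∘ₗ F p) (σ i) i) =
      LinearMap.toContinuousLinearMap (b.coord (σ i) ∘ₗ e.toLinearMap) ∘ fun p => F p (b i) by
        ext p; simp [LinearMap.toMatrix_apply]]
    exact (ContinuousLinearMap.contDiff _).comp (hF (b i))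
  filter_upwards [hcont.ae_ne_zero μ ((hdet p₀).2 hp₀)] with p hp using (hdet p).1 hp

theorem ae_receiverMap_injective (j : Fin 3) :
    ∀ᵐ H ∂(volume : Measure (Fin 3 → Fin 3 → Fin 3 → Fin 2 → ℂ)),
      Function.Injective (receiverMap H j) := by
  have : (volume : Measure (Fin 2 → ℂ)).IsAddHaarMeasure := Measure.pi.isAddHaarMeasure _
  have : (volume : Measure (Fin 3 → Fin 2 → ℂ)).IsAddHaarMeasure := Measure.pi.isAddHaarMeasure _
  have : (volume : Measure (Fin 3 → Fin 3 → Fin 2 → ℂ)).IsAddHaarMeasure :=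
    Measure.pi.isAddHaarMeasure _
  have : (volume : Measure (Fin 3 → Fin 3 → Fin 3 → Fin 2 → ℂ)).IsAddHaarMeasure :=
    Measure.pi.isAddHaarMeasure _
  exact ae_injective_of_contDiff volume (by simp [Module.finrank_pi_fintype])
    (contDiff_receiverMap j) (receiverMap_separatedChannel_injective j)

/-- Achievability part of Theorem 1 of the paper: for Lebesgue-almost every tuple of nine
complex 3×2 channel matrices `H̄_{j,i}` of the 3-user (2,3) MIMO IC, with `T = 5` symbol
extensions and asymmetric complex signaling, there are linear precoders
`V_i ∈ ℝ^{20×12}` and receive filters `W_j ∈ ℝ^{12×30}` that zero-force all interference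
(`W_j H_{j,i} V_i = 0` for `i ≠ j`) while keeping `W_j H_{j,j} V_j` invertible,
i.e. each user achieves `12/10 = 6/5` degrees of freedom. -/
theorem dof_achievability_23 :
    ∀ᵐ H ∂(volume : Measure (Fin 3 → Fin 3 → Fin 3 → Fin 2 → ℂ)),
      ∃ (V : Fin 3 → Matrix (Fin 20) (Fin 12) ℝ)
        (W : Fin 3 → Matrix (Fin 12) (Fin 30) ℝ),
        (∀ j i, i ≠ j → W j * Hext H j i * V i = 0) ∧
        ∀ j, IsUnit (W j * Hext H j j * V j) := by
  filter_upwards [ae_all_iff.2 ae_receiverMap_injective] with H hH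
  choose w hw₀ hw₁ using fun j => exists_zeroForcing (hH j)
  have hdim : Module.finrank ℝ (Fin 12 → ℝ) =
      Module.finrank ℝ ((Fin 3 → ℂ) × (Fin 3 → ℂ)) := by
    simp [Module.finrank_pi_fintype]
  let e := LinearEquiv.ofFinrankEq (Fin 12 → ℝ) ((Fin 3 → ℂ) × (Fin 3 → ℂ)) hdim
  let V (i : Fin 3) : Matrix (Fin 20) (Fin 12) ℝ :=
    LinearMap.toMatrix' ((realify 2).toLinearMap ∘ₗ precoder H i ∘ₗ e.toLinearMap)
  let W (j : Fin 3) : Matrix (Fin 12) (Fin 30) ℝ :=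
    LinearMap.toMatrix' (e.symm.toLinearMap ∘ₗ w j ∘ₗ (realify 3).symm.toLinearMap)
  have hprod (j i : Fin 3) : W j * Hext H j i * V i = LinearMap.toMatrix'
      (e.symm.toLinearMap ∘ₗ (w j ∘ₗ channelMap (H j i) ∘ₗ precoder H i) ∘ₗ e.toLinearMap) := by
    rw [Hext_eq_toMatrix', ← LinearMap.toMatrix'_comp, ← LinearMap.toMatrix'_comp]
    congr 1
    ext x
    simp
  refine ⟨V, W, fun j i hij => ?_, fun j => ?_⟩
  · rw [hprod, hw₀ j i hij]
    simp
  · have hone : W j * Hext H j j * V j = 1 := by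
      rw [hprod, hw₁ j, LinearMap.id_comp, LinearEquiv.symm_comp]
      exact LinearMap.toMatrix'_id
    exact hone ▸ isUnit_one
end

section
/- Let m ≥ 1 and let A_1, A_2, A_3 ∈ ℂ^{5m×3m} be complex matrices such that A_1 and A_2 share a common nonzero column (i.e., there exist column indices q_1, q_2 with column q_1 of A_1 equal to column q_2 of A_2 and nonzero). For ANY complex numbers h^{1,1}, h^{1,2}, h^{2,1}, h^{2,2}, h^{3,1}, h^{3,2}, θ_1, θ_2, θ_3, the 15m×15m complex block matrix G with 5m×3m blocks given by: row 1 = [h^{1,1}A_2, h^{1,2}A_1, θ_1 A_1, 0, 0]; row 2 = [h^{2,1}A_2, h^{2,2}A_1, 0, θ_2 A_3, 0]; row 3 = [h^{3,1}A_2, h^{3,2}A_1, 0, 0, θ_3 A_2], is singular (its kernel contains a nonzero vector). -/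
open Matrix

/-- The vector of length `C * n` whose `c`-th block of length `n` is `v c`. -/
def blkVec {α : Type*} {C n : ℕ} (v : Fin C → Fin n → α) : Fin (C * n) → α :=
  fun j => v j.divNat j.modNat

lemma blkVec_finProdFinEquiv {α : Type*} {C n : ℕ} (v : Fin C → Fin n → α)
    (p : Fin C × Fin n) : blkVec v (finProdFinEquiv p) = v p.1 p.2 :=
  congrArg (fun q : Fin C × Fin n => v q.1 q.2) (finProdFinEquiv.symm_apply_apply p)

lemma blkVec_ne_zero {α : Type*} [Zero α] {C n : ℕ} {v : Fin C → Fin n → α} (hv : v ≠ 0) :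
    blkVec v ≠ 0 := by
  contrapose! hv
  ext c k
  rw [← blkVec_finProdFinEquiv v (c, k), hv]
  rfl

lemma blk_mulVec_blkVec {α : Type*} [NonUnitalNonAssocSemiring α] {R C m n : ℕ}
    (f : Fin R → Fin C → Matrix (Fin m) (Fin n) α) (v : Fin C → Fin n → α) :
    blk f *ᵥ blkVec v = blkVec fun r => ∑ c, f r c *ᵥ v c := by
  ext i
  simp only [blkVec, Finset.sum_apply]
  exact (Equiv.sum_comp finProdFinEquiv.symm
    (fun p => f i.divNat p.1 i.modNat p.2 * v p.1 p.2)).trans (Fintype.sum_prod_type _)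

/-- The scalar system obtained by restricting to a common column has more unknowns than
equations. -/
lemma exists_ne_zero_scalar_solution {K : Type*} [Field K]
    (h11 h12 h21 h22 h31 h32 θ₁ θ₃ : K) :
    ∃ c : Fin 4 → K, c ≠ 0 ∧ h11 * c 0 + h12 * c 1 + θ₁ * c 2 = 0 ∧
      h21 * c 0 + h22 * c 1 = 0 ∧ h31 * c 0 + h32 * c 1 + θ₃ * c 3 = 0 := by
  let M : Matrix (Fin 3) (Fin 4) K := !![h11, h12, θ₁, 0; h21, h22, 0, 0; h31, h32, 0, θ₃]
  obtain ⟨c, hc, hc0⟩ := (Submodule.ne_bot_iff _).mp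
    (LinearMap.ker_ne_bot_of_finrank_lt (f := M.mulVecLin) (by simp))
  rw [LinearMap.mem_ker, mulVecLin_apply] at hc
  refine ⟨c, hc0, ?_, ?_, ?_⟩
  · simpa [M, mulVec, dotProduct, Fin.sum_univ_four] using congrFun hc 0
  · simpa [M, mulVec, dotProduct, Fin.sum_univ_four] using congrFun hc 1
  · simpa [M, mulVec, dotProduct, Fin.sum_univ_four] using congrFun hc 2

/-- Without asymmetric complex signaling (channel blocks are scalar multiples of the
identity over ℂ), the signal space matrix of the (2,3) alignment-chain scheme is
singular for every choice of channel coefficients: if `A₁, A₂, A₃ ∈ ℂ^{5m×3m}` are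
such that `A₁` and `A₂` share a common nonzero column, then for any complex numbers
`h^{1,1}, h^{1,2}, h^{2,1}, h^{2,2}, h^{3,1}, h^{3,2}, θ₁, θ₂, θ₃`, the `15m×15m` block
matrix `G` with rows `[h^{1,1}A₂, h^{1,2}A₁, θ₁A₁, 0, 0]`,
`[h^{2,1}A₂, h^{2,2}A₁, 0, θ₂A₃, 0]`, `[h^{3,1}A₂, h^{3,2}A₁, 0, 0, θ₃A₂]` has a
nonzero vector in its kernel. -/
theorem no_acs_rank_deficient (m : ℕ) (hm : 1 ≤ m)
    (A₁ A₂ A₃ : Matrix (Fin (5 * m)) (Fin (3 * m)) ℂ)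
    (hcol : ∃ q₁ q₂ : Fin (3 * m),
      (fun i => A₁ i q₁) = (fun i => A₂ i q₂) ∧ (fun i => A₁ i q₁) ≠ 0)
    (h11 h12 h21 h22 h31 h32 θ₁ θ₂ θ₃ : ℂ) :
    ∃ x : Fin (5 * (3 * m)) → ℂ, x ≠ 0 ∧
      (blk (R := 3) (C := 5) (m := 5 * m) (n := 3 * m)
        !![h11 • A₂, h12 • A₁, θ₁ • A₁, 0, 0;
           h21 • A₂, h22 • A₁, 0, θ₂ • A₃, 0;
           h31 • A₂, h32 • A₁, 0, 0, θ₃ • A₂]).mulVec x = 0 := by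
  obtain ⟨q₁, q₂, hq, -⟩ := hcol
  obtain ⟨c, hc, e1, e2, e3⟩ :=
    exists_ne_zero_scalar_solution h11 h12 h21 h22 h31 h32 θ₁ θ₃
  refine ⟨blkVec ![Pi.single q₂ (c 0), Pi.single q₁ (c 1), Pi.single q₁ (c 2), 0,
    Pi.single q₂ (c 3)], blkVec_ne_zero fun hv => hc ?_, ?_⟩
  · ext i
    fin_cases i
    · simpa using congrFun hv 0
    · simpa using congrFun hv 1
    · simpa using congrFun hv 2
    · simpa using congrFun hv 4
  · refine (blk_mulVec_blkVec _ _).trans ?_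
    ext i
    have hi (k : Fin (5 * m)) : A₁ k q₁ = A₂ k q₂ := congrFun hq k
    generalize hr : i.divNat = r
    simp only [blkVec, hr]
    fin_cases r
    · simp [Fin.sum_univ_five, hi]
      linear_combination A₂ i.modNat q₂ * e1
    · simp [Fin.sum_univ_five, hi]
      linear_combination A₂ i.modNat q₂ * e2
    · simp [Fin.sum_univ_five, hi]
      linear_combination A₂ i.modNat q₂ * e3
end

section
/- Let T = 7 and let h_1, …, h_{16} be nonzero complex numbers. Let E be the 8×9 block matrix with 14×14 real blocks, whose only nonzero blocks are C_T(h_1) at position (1,1); C_T(h_2), C_T(h_3), C_T(h_4) at positions (2,2), (2,3), (2,4); C_T(h_5), C_T(h_6), C_T(h_7) at (3,3), (3,4), (3,5); C_T(h_8) at (4,6); C_T(h_9) at (5,4); C_T(h_{10}), C_T(h_{11}), C_T(h_{12}) at (6,5), (6,6), (6,7); C_T(h_{13}), C_T(h_{14}), C_T(h_{15}) at (7,6), (7,7), (7,8); and C_T(h_{16}) at (8,9). Then every block column matrix F = [F_1; …; F_9] with F_i ∈ ℝ^{14×d} satisfying E·F = 0 has F_1 = 0, F_4 = 0, F_6 =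 0, and F_9 = 0. -/
open Matrix

/-- The 8×9 block matrix (14×14 blocks, `T = 7`) of the first alignment chain of the
3-user (3,4) MIMO IC after the change of basis, with nonzero blocks
`C_T(h₁)` at (1,1); `C_T(h₂),C_T(h₃),C_T(h₄)` at (2,2),(2,3),(2,4);
`C_T(h₅),C_T(h₆),C_T(h₇)` at (3,3),(3,4),(3,5); `C_T(h₈)` at (4,6); `C_T(h₉)` at (5,4);
`C_T(h₁₀),C_T(h₁₁),C_T(h₁₂)` at (6,5),(6,6),(6,7);
`C_T(h₁₃),C_T(h₁₄),C_T(h₁₅)` at (7,6),(7,7),(7,8); `C_T(h₁₆)` at (8,9). -/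
noncomputable def Echain (h : Fin 16 → ℂ) : Matrix (Fin (8 * 14)) (Fin (9 * 14)) ℝ :=
  blk (R := 8) (C := 9) (m := 14) (n := 14)
    !![Cmat 7 (h 0), 0, 0, 0, 0, 0, 0, 0, 0;
       0, Cmat 7 (h 1), Cmat 7 (h 2), Cmat 7 (h 3), 0, 0, 0, 0, 0;
       0, 0, Cmat 7 (h 4), Cmat 7 (h 5), Cmat 7 (h 6), 0, 0, 0, 0;
       0, 0, 0, 0, 0, Cmat 7 (h 7), 0, 0, 0;
       0, 0, 0, Cmat 7 (h 8), 0, 0, 0, 0, 0;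
       0, 0, 0, 0, Cmat 7 (h 9), Cmat 7 (h 10), Cmat 7 (h 11), 0, 0;
       0, 0, 0, 0, 0, Cmat 7 (h 12), Cmat 7 (h 13), Cmat 7 (h 14), 0;
       0, 0, 0, 0, 0, 0, 0, 0, Cmat 7 (h 15)]

open scoped Kronecker

theorem blk_apply_finProdFinEquiv {α : Type*} {R C m n : ℕ}
    (f : Fin R → Fin C → Matrix (Fin m) (Fin n) α) (r : Fin R) (i : Fin m) (c : Fin C)
    (j : Fin n) :
    blk f (finProdFinEquiv (r, i)) (finProdFinEquiv (c, j)) = f r c i j := by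
  have hm : 0 < m := i.pos
  have hn : 0 < n := j.pos
  simp [blk, Nat.add_mul_div_left, Nat.add_mul_mod_self_left, Nat.div_eq_of_lt, Nat.mod_eq_of_lt,
    hm, hn]

theorem blk_mul_blk_apply {α : Type*} [NonUnitalNonAssocSemiring α] {R C S m n p : ℕ}
    (f : Fin R → Fin C → Matrix (Fin m) (Fin n) α)
    (g : Fin C → Fin S → Matrix (Fin n) (Fin p) α) (r : Fin R) (i : Fin m) (c : Fin S)
    (j : Fin p) :
    (blk f * blk g) (finProdFinEquiv (r, i)) (finProdFinEquiv (c, j)) =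
      (∑ k, f r k * g k c) i j := by
  rw [Matrix.mul_apply, ← finProdFinEquiv.sum_comp, Fintype.sum_prod_type, Matrix.sum_apply]
  simp only [blk_apply_finProdFinEquiv, Matrix.mul_apply]

theorem sum_mul_eq_zero_of_blk_mul_blk_eq_zero {α : Type*} [NonUnitalNonAssocSemiring α]
    {R C S m n p : ℕ} {f : Fin R → Fin C → Matrix (Fin m) (Fin n) α}
    {g : Fin C → Fin S → Matrix (Fin n) (Fin p) α} (h : blk f * blk g = 0) (r : Fin R)
    (c : Fin S) : ∑ k, f r k * g k c = 0 := by
  ext i j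
  rw [← blk_mul_blk_apply, h]
  rfl

theorem Cmat_eq_submatrix_kronecker (T : ℕ) (h : ℂ) :
    Cmat T h = ((1 : Matrix (Fin T) (Fin T) ℝ) ⊗ₖ !![h.re, -h.im; h.im, h.re]).submatrix
      (finProdFinEquiv.trans (finCongr (Nat.mul_comm T 2))).symm
      (finProdFinEquiv.trans (finCongr (Nat.mul_comm T 2))).symm := by
  ext i j
  simp [Cmat, Matrix.kroneckerMap_apply, Matrix.one_apply, Fin.ext_iff, Fin.divNat, Fin.modNat]

theorem det_Cmat_ne_zero (T : ℕ) {h : ℂ} (hh : h ≠ 0) : (Cmat T h).det ≠ 0 := by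
  rw [Cmat_eq_submatrix_kronecker, Matrix.det_submatrix_equiv_self, Matrix.det_kronecker,
    Matrix.det_fin_two_of]
  have hpos := Complex.normSq_pos.mpr hh
  rw [Complex.normSq_apply] at hpos
  simp only [Matrix.det_one, one_pow, one_mul, neg_mul, sub_neg_eq_add]
  exact pow_ne_zero _ hpos.ne'

theorem eq_zero_of_Cmat_mul_eq_zero {T : ℕ} {h : ℂ} (hh : h ≠ 0) {n : Type*}
    {M : Matrix (Fin (2 * T)) n ℝ} (hM : Cmat T h * M = 0) : M = 0 := by
  rw [← Matrix.nonsing_inv_mul_cancel_left (Cmat T h) M (det_Cmat_ne_zero T hh).isUnit, hM,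
    Matrix.mul_zero]

/-- Output of the Zero Propagation algorithm for the first alignment chain of the (3,4)
case: for nonzero `h₁,…,h₁₆`, every block column matrix `F = [F₁; …; F₉]` with
`F_i ∈ ℝ^{14×d}` satisfying `E·F = 0` has `F₁ = 0`, `F₄ = 0`, `F₆ = 0` and `F₉ = 0`. -/
theorem zero_propagation_34 (h : Fin 16 → ℂ) (h0 : ∀ k, h k ≠ 0) (d : ℕ)
    (Fv : Fin 9 → Matrix (Fin 14) (Fin d) ℝ)
    (hEF : Echain h * blk (fun c (_ : Fin 1) => Fv c) = 0) :
    Fv 0 = 0 ∧ Fv 3 = 0 ∧ Fv 5 = 0 ∧ Fv 8 = 0 := by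
  have hrow := fun r => sum_mul_eq_zero_of_blk_mul_blk_eq_zero hEF r 0
  refine ⟨eq_zero_of_Cmat_mul_eq_zero (T := 7) (h0 0) ?_,
    eq_zero_of_Cmat_mul_eq_zero (T := 7) (h0 8) ?_,
    eq_zero_of_Cmat_mul_eq_zero (T := 7) (h0 7) ?_,
    eq_zero_of_Cmat_mul_eq_zero (T := 7) (h0 15) ?_⟩
  · simpa [Fin.sum_univ_succ] using hrow 0
  · simpa [Fin.sum_univ_succ] using hrow 4
  · simpa [Fin.sum_univ_succ] using hrow 3
  · simpa [Fin.sum_univ_succ] using hrow 7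
end
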